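/- Let -1 < m \le 0. Define S_m := \{ (u,a) \in \mathbb{R}^2 : a \ge 0,\ x := 4u^2m^2 - 4a^2 > -\pi^2,\ 4u^2m^2 + 4a^2 m < C(x)/(2 S'(x)) \} and let \Sigma_m be the connected component of (0,0) in S_m. Then the map \Phi_m is injective on \Sigma_m. (Hence the polar map P_m of the maximal adapted complexification \Omega_m of (SL_2(\mathbb{R}), \nu_m) is injective for -1 < m \le 0.) -/

import Mathlib

open Real

/-- `C x = ∑ xⁿ/(2n)!`, i.e. `cosh √x` for `x ≥ 0` and `cos √(-x)` for `x ≤ 0`. -/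
noncomputable def C (x : ℝ) : ℝ := ∑' n : ℕ, x ^ n / (Nat.factorial (2 * n))

/-- `S x = ∑ xⁿ/(2n+1)!`, i.e. `sinh √x/√x` for `x > 0` and `sin √(-x)/√(-x)` for `x < 0`. -/
noncomputable def S (x : ℝ) : ℝ := ∑' n : ℕ, x ^ n / (Nat.factorial (2 * n + 1))

/-- The reduced polar map `Φₘ = P̂ₘ` of the metric `νₘ` on `SL₂(ℝ)` in the slice
coordinates `(u, a)`, with `x = 4u²m² - 4a²`. -/
noncomputable def Phi (m : ℝ) (p : ℝ × ℝ) : ℝ × ℝ :=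
  (Real.exp (-(2 * p.1 * (1 + m))) *
      (C (4 * p.1 ^ 2 * m ^ 2 - 4 * p.2 ^ 2) +
        2 * p.1 * m * S (4 * p.1 ^ 2 * m ^ 2 - 4 * p.2 ^ 2)),
   Real.exp (2 * p.1 * (1 + m)) *
      (C (4 * p.1 ^ 2 * m ^ 2 - 4 * p.2 ^ 2) -
        2 * p.1 * m * S (4 * p.1 ^ 2 * m ^ 2 - 4 * p.2 ^ 2)))

/-- The sum `∑ aₙ xⁿ` of a real power series. -/
noncomputable def powSum (a : ℕ → ℝ) (x : ℝ) : ℝ := ∑' n : ℕ, a n * x ^ n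

/-- The coefficients of the termwise derivative of a power series. -/
def derivCoeff (a : ℕ → ℝ) (n : ℕ) : ℝ := (n + 1) * a (n + 1)

theorem abs_derivCoeff_le {a : ℕ → ℝ} (ha : ∀ n, |a n| ≤ 1 / n.factorial) (n : ℕ) :
    |derivCoeff a n| ≤ 1 / n.factorial := by
  have h := ha (n + 1)
  have hn : (0 : ℝ) < n + 1 := by positivity
  rw [derivCoeff, abs_mul, abs_of_pos hn]
  calc (n + 1 : ℝ) * |a (n + 1)| ≤ (n + 1) * (1 / (n + 1).factorial) := by gcongr
    _ = 1 / n.factorial := by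
      rw [Nat.factorial_succ]; push_cast; field_simp

theorem summable_powSum {a : ℕ → ℝ} (ha : ∀ n, |a n| ≤ 1 / n.factorial) (x : ℝ) :
    Summable fun n => a n * x ^ n := by
  refine Summable.of_norm_bounded (Real.summable_pow_div_factorial |x|) fun n => ?_
  rw [Real.norm_eq_abs, abs_mul, abs_pow]
  calc |a n| * |x| ^ n ≤ 1 / n.factorial * |x| ^ n := by gcongr; exact ha n
    _ = |x| ^ n / n.factorial := by ring

theorem powSum_zero (a : ℕ → ℝ) : powSum a 0 = a 0 := by
  rw [powSum, tsum_eq_single 0 fun n hn => by simp [hn]]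
  simp

theorem powSum_eq_add {a : ℕ → ℝ} (ha : ∀ n, |a n| ≤ 1 / n.factorial) (x : ℝ) :
    powSum a x = a 0 + ∑' n : ℕ, a (n + 1) * x ^ (n + 1) := by
  rw [powSum, (summable_powSum ha x).tsum_eq_zero_add]
  simp

theorem hasDerivAt_powSum {a : ℕ → ℝ} (ha : ∀ n, |a n| ≤ 1 / n.factorial) (x : ℝ) :
    HasDerivAt (powSum a) (powSum (derivCoeff a) x) x := by
  have hb : ∀ n, |derivCoeff a n| ≤ 1 / n.factorial := abs_derivCoeff_le ha
  have hfun : powSum a = fun y => a 0 + ∑' n : ℕ, a (n + 1) * y ^ (n + 1) :=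
    funext (powSum_eq_add ha)
  rw [hfun]
  refine HasDerivAt.const_add _ ?_
  refine hasDerivAt_tsum_of_isPreconnected (t := Metric.ball 0 (|x| + 1)) (y₀ := 0)
    (u := fun n => (|x| + 1) ^ n / n.factorial)
    (g' := fun n y => derivCoeff a n * y ^ n)
    (Real.summable_pow_div_factorial _) Metric.isOpen_ball
    (convex_ball _ _).isPreconnected ?_ ?_ ?_ ?_ ?_
  · intro n y _
    refine ((hasDerivAt_pow (n + 1) y).const_mul (a (n + 1))).congr_deriv ?_
    simp only [derivCoeff, Nat.add_sub_cancel]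
    push_cast
    ring
  · intro n y hy
    rw [mem_ball_zero_iff, Real.norm_eq_abs] at hy
    rw [Real.norm_eq_abs, abs_mul, abs_pow]
    calc |derivCoeff a n| * |y| ^ n ≤ 1 / n.factorial * (|x| + 1) ^ n := by
          gcongr
          exact hb n
      _ = (|x| + 1) ^ n / n.factorial := by ring
  · exact Metric.mem_ball_self (by positivity)
  · simp [summable_zero]
  · rw [mem_ball_zero_iff, Real.norm_eq_abs]
    linarith

theorem C_eq_powSum : C = powSum fun n => 1 / (2 * n).factorial := by
  funext x
  exact tsum_congr fun n => by ring

theorem S_eq_powSum : S = powSum fun n => 1 / (2 * n + 1).factorial := by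
  funext x
  exact tsum_congr fun n => by ring

theorem abs_one_div_factorial_le {k n : ℕ} (h : n ≤ k) :
    |(1 : ℝ) / k.factorial| ≤ 1 / n.factorial := by
  rw [abs_of_nonneg (by positivity)]
  have := Nat.factorial_le h
  gcongr

theorem deriv_powSum {a : ℕ → ℝ} (ha : ∀ n, |a n| ≤ 1 / n.factorial) :
    deriv (powSum a) = powSum (derivCoeff a) :=
  funext fun x => (hasDerivAt_powSum ha x).deriv

theorem abs_coeff_S_le (n : ℕ) : |(1 : ℝ) / (2 * n + 1).factorial| ≤ 1 / n.factorial :=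
  abs_one_div_factorial_le (by omega)

theorem abs_coeff_C_le (n : ℕ) : |(1 : ℝ) / (2 * n).factorial| ≤ 1 / n.factorial :=
  abs_one_div_factorial_le (by omega)

theorem hasDerivAt_S (x : ℝ) : HasDerivAt S (deriv S x) x := by
  rw [S_eq_powSum, deriv_powSum abs_coeff_S_le]
  exact hasDerivAt_powSum abs_coeff_S_le x

theorem hasDerivAt_deriv_S (x : ℝ) : HasDerivAt (deriv S) (deriv (deriv S) x) x := by
  have h := abs_derivCoeff_le abs_coeff_S_le
  rw [S_eq_powSum, deriv_powSum abs_coeff_S_le, deriv_powSum h]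
  exact hasDerivAt_powSum h x

theorem hasDerivAt_deriv_deriv_S (x : ℝ) :
    HasDerivAt (deriv (deriv S)) (deriv (deriv (deriv S)) x) x := by
  have h := abs_derivCoeff_le abs_coeff_S_le
  have h' := abs_derivCoeff_le h
  rw [S_eq_powSum, deriv_powSum abs_coeff_S_le, deriv_powSum h, deriv_powSum h']
  exact hasDerivAt_powSum h' x

theorem hasDerivAt_C (x : ℝ) : HasDerivAt C (S x / 2) x := by
  have h := hasDerivAt_powSum abs_coeff_C_le x
  rw [← C_eq_powSum] at h
  convert h using 1
  rw [S, powSum, ← tsum_div_const]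
  refine tsum_congr fun n => ?_
  rw [derivCoeff, show 2 * (n + 1) = 2 * n + 1 + 1 by ring, Nat.factorial_succ (2 * n + 1)]
  push_cast
  field_simp
  ring

theorem C_eq_S_add (x : ℝ) : C x = S x + 2 * x * deriv S x := by
  have hS := powSum_eq_add abs_coeff_S_le x
  have hC := powSum_eq_add abs_coeff_C_le x
  have s₁ := (summable_nat_add_iff 1).2 (summable_powSum abs_coeff_S_le x)
  have s₂ := summable_powSum (abs_derivCoeff_le abs_coeff_S_le) x
  rw [C_eq_powSum, S_eq_powSum, deriv_powSum abs_coeff_S_le, hS, hC, powSum, ← tsum_mul_left,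
    add_assoc, ← Summable.tsum_add s₁ (s₂.mul_left _)]
  simp only [mul_zero, zero_add, Nat.factorial_zero, Nat.factorial_one, add_right_inj]
  refine tsum_congr fun n => ?_
  simp only [derivCoeff]
  rw [Nat.factorial_succ (2 * (n + 1))]
  push_cast
  field_simp
  ring

theorem C_zero : C 0 = 1 := by simp [C_eq_powSum, powSum_zero]

theorem C_sq (x : ℝ) : C x ^ 2 = 1 + x * S x ^ 2 := by
  have hd : ∀ y, HasDerivAt (fun y => C y ^ 2 - y * S y ^ 2) 0 y := fun y => by
    refine (((hasDerivAt_C y).pow 2).sub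
      ((hasDerivAt_id y).mul ((hasDerivAt_S y).pow 2))).congr_deriv ?_
    simp only [id, C_eq_S_add y, Nat.add_one_sub_one, pow_one, Pi.pow_apply, Nat.cast_ofNat]
    ring
  have h := is_const_of_deriv_eq_zero (fun y => (hd y).differentiableAt) (fun y => (hd y).deriv) x 0
  simp only [C_zero] at h
  linarith

theorem deriv_deriv_S (x : ℝ) : 4 * x * deriv (deriv S) x = S x - 6 * deriv S x := by
  have h := ((hasDerivAt_S x).add (((hasDerivAt_id x).const_mul 2).mul (hasDerivAt_deriv_S x)))
  have hC : C = S + (fun y => 2 * id y) * deriv S := funext fun y => by simp [C_eq_S_add y]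
  rw [← hC] at h
  have := h.unique (hasDerivAt_C x)
  simp only [id] at this
  linarith

theorem mul_S_neg_sq (s : ℝ) : s * S (-s ^ 2) = sin s := by
  rw [Real.sin_eq_tsum, S, ← tsum_mul_left]
  refine tsum_congr fun n => ?_
  rw [neg_pow, ← pow_mul]
  ring

theorem S_pos {x : ℝ} (hx : -π ^ 2 < x) : 0 < S x := by
  rcases le_or_gt 0 x with h | h
  · rw [S_eq_powSum]
    refine (summable_powSum abs_coeff_S_le x).tsum_pos (fun n => by positivity) 0 (by simp)
  · have hs : 0 < √(-x) := Real.sqrt_pos.2 (by linarith)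
    have hπ : √(-x) < π := by
      rw [Real.sqrt_lt' pi_pos]
      linarith
    have := mul_S_neg_sq √(-x)
    rw [Real.sq_sqrt (by linarith), neg_neg] at this
    exact pos_of_mul_pos_right (this ▸ sin_pos_of_pos_of_lt_pi hs hπ) hs.le

/-- If `k f + 2 x f'` is positive on `(-π², ∞)`, so is `f`: `l ↦ lᵏ f (l² x)` increases on `[0, 1]`
from `0` to `f x`. -/
theorem pos_of_mul_add_mul_deriv_pos {f f' : ℝ → ℝ} (k : ℕ) (hf : ∀ x, HasDerivAt f (f' x) x)
    (h : ∀ x, -π ^ 2 < x → 0 < (k + 1) * f x + 2 * x * f' x) {x : ℝ} (hx : -π ^ 2 < x) :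
    0 < f x := by
  have hd : ∀ l, HasDerivAt (fun l => l ^ (k + 1) * f (l ^ 2 * x))
      (l ^ k * ((k + 1) * f (l ^ 2 * x) + 2 * (l ^ 2 * x) * f' (l ^ 2 * x))) l := fun l => by
    have h₂ : HasDerivAt (fun l => l ^ 2 * x) (2 * l * x) l := by
      simpa using (hasDerivAt_pow 2 l).mul_const x
    refine ((hasDerivAt_pow (k + 1) l).mul ((hf (l ^ 2 * x)).comp l h₂)).congr_deriv ?_
    simp only [Nat.add_sub_cancel, Function.comp_apply]
    push_cast
    ring
  have hmono : StrictMonoOn (fun l => l ^ (k + 1) * f (l ^ 2 * x)) (Set.Icc 0 1) := by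
    refine strictMonoOn_of_deriv_pos (convex_Icc _ _)
      (fun l _ => (hd l).continuousAt.continuousWithinAt) fun l hl => ?_
    rw [interior_Icc] at hl
    rw [(hd l).deriv]
    refine mul_pos (pow_pos hl.1 k) (h _ ?_)
    have h0 : l ^ 2 < 1 := by nlinarith [hl.1, hl.2]
    have h1 : 0 < l ^ 2 := pow_pos hl.1 2
    nlinarith [pow_pos pi_pos 2]
  simpa using hmono (Set.left_mem_Icc.2 zero_le_one) (Set.right_mem_Icc.2 zero_le_one) zero_lt_one

theorem deriv_S_pos {x : ℝ} (hx : -π ^ 2 < x) : 0 < deriv S x := by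
  refine pos_of_mul_add_mul_deriv_pos 2 hasDerivAt_deriv_S (fun y hy => ?_) hx
  have := deriv_deriv_S y
  have := S_pos hy
  push_cast
  linarith

theorem S_mul_deriv_deriv_S_lt {x : ℝ} (hx : -π ^ 2 < x) :
    S x * deriv (deriv S) x < 3 * deriv S x ^ 2 := by
  have hd : ∀ y, HasDerivAt (fun y => 3 * deriv S y ^ 2 - S y * deriv (deriv S) y)
      (5 * deriv S y * deriv (deriv S) y - S y * deriv (deriv (deriv S)) y) y := fun y => by
    refine ((((hasDerivAt_deriv_S y).pow 2).const_mul 3).sub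
      ((hasDerivAt_S y).mul (hasDerivAt_deriv_deriv_S y))).congr_deriv ?_
    push_cast
    ring
  refine sub_pos.1 (pos_of_mul_add_mul_deriv_pos 4 hd (fun y hy => ?_) hx)
  have h₂ := deriv_deriv_S y
  have h₃ : 4 * y * deriv (deriv (deriv S)) y = deriv S y - 10 * deriv (deriv S) y := by
    have hl := ((hasDerivAt_id y).const_mul 4).mul (hasDerivAt_deriv_deriv_S y)
    have hr := (hasDerivAt_S y).sub ((hasDerivAt_deriv_S y).const_mul 6)
    have hlr : (fun y => 4 * id y) * deriv (deriv S) = S - fun y => 6 * deriv S y :=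
      funext fun z => by simp [deriv_deriv_S z]
    rw [hlr] at hl
    have := hl.unique hr
    simp only [id] at this
    linarith
  have hS := S_pos hy
  have hS' := deriv_S_pos hy
  have key : (((4 : ℕ) : ℝ) + 1) * (3 * deriv S y ^ 2 - S y * deriv (deriv S) y) +
      2 * y * (5 * deriv S y * deriv (deriv S) y - S y * deriv (deriv (deriv S)) y) =
      2 * (S y * deriv S y) := by
    push_cast
    linear_combination (5 / 2 * deriv S y) * h₂ - (S y / 2) * h₃
  rw [key]
  positivity

theorem strictMonoOn_C : StrictMonoOn C (Set.Ioi (-π ^ 2)) := by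
  refine strictMonoOn_of_deriv_pos (convex_Ioi _)
    (fun x _ => (hasDerivAt_C x).continuousAt.continuousWithinAt) fun x hx => ?_
  rw [interior_Ioi] at hx
  rw [(hasDerivAt_C x).deriv]
  exact half_pos (S_pos hx)

theorem antitoneOn_deriv_S_div_S_pow :
    AntitoneOn (fun x => deriv S x / S x ^ 3) (Set.Ioi (-π ^ 2)) := by
  have hd : ∀ x, -π ^ 2 < x → HasDerivAt (fun x => deriv S x / S x ^ 3)
      ((deriv (deriv S) x * S x ^ 3 - deriv S x * (3 * S x ^ 2 * deriv S x)) / (S x ^ 3) ^ 2) x :=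
    fun x hx => by
      have := (S_pos hx).ne'
      refine ((hasDerivAt_deriv_S x).div ((hasDerivAt_S x).pow 3)
        (pow_ne_zero 3 this)).congr_deriv ?_
      simp
  refine antitoneOn_of_deriv_nonpos (convex_Ioi _)
    (fun x hx => (hd x hx).continuousAt.continuousWithinAt) (fun x hx => ?_) fun x hx => ?_ <;>
    rw [interior_Ioi] at hx
  · exact (hd x hx).differentiableAt.differentiableWithinAt
  · rw [(hd x hx).deriv]
    refine div_nonpos_of_nonpos_of_nonneg ?_ (by positivity)
    have h := S_mul_deriv_deriv_S_lt hx
    have := pow_pos (S_pos hx) 2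
    nlinarith

/-- Up to the factor `k` relating `u` and `w`, the components of `Phi m (u, a)` are
`branch k (∓w) x` with `w = -2um`. -/
noncomputable def branch (k w x : ℝ) : ℝ := exp (k * w) * (C x + w * S x)

theorem branch_mul_branch_neg (k : ℝ) {w b x : ℝ} (hx : x = w ^ 2 - b ^ 2) :
    branch k w x * branch k (-w) x = 1 - (b * S x) ^ 2 := by
  have he : exp (k * w) * exp (k * -w) = 1 := by rw [← exp_add]; simp
  calc branch k w x * branch k (-w) x
      = exp (k * w) * exp (k * -w) * (C x ^ 2 - w ^ 2 * S x ^ 2) := by unfold branch; ring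
    _ = 1 - (b * S x) ^ 2 := by rw [he, C_sq, hx]; ring

theorem C_sq_eq {w b x : ℝ} (hx : x = w ^ 2 - b ^ 2) :
    C x ^ 2 = 1 - (b * S x) ^ 2 + (w * S x) ^ 2 := by
  linear_combination C_sq x + S x ^ 2 * hx

theorem C_eq_branch (k w x : ℝ) :
    2 * C x = exp (k * -w) * branch k w x + exp (k * w) * branch k (-w) x := by
  have he : exp (k * w) * exp (k * -w) = 1 := by rw [← exp_add]; simp
  unfold branch
  linear_combination (-2 * C x) * he

theorem hasDerivAt_branch (k : ℝ) {r x : ℝ} {w : ℝ → ℝ} (hS : S x ≠ 0)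
    (hw : w x ^ 2 = x + (r / S x) ^ 2) (hw₀ : w x ≠ 0)
    (hd : HasDerivAt w ((1 - 2 * r ^ 2 * (deriv S x / S x ^ 3)) / (2 * w x)) x) :
    HasDerivAt (fun x => branch k (w x) x) (branch k (w x) x *
      ((k * (1 - 2 * r ^ 2 * (deriv S x / S x ^ 3)) + 1) / (2 * w x))) x := by
  refine ((hd.const_mul k).exp.mul
    ((hasDerivAt_C x).add (hd.mul (hasDerivAt_S x)))).congr_deriv ?_
  set g := 1 - 2 * r ^ 2 * (deriv S x / S x ^ 3) with hg
  have key : g * S x + 2 * w x ^ 2 * deriv S x = C x := by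
    rw [hw, C_eq_S_add, hg]
    field_simp
    ring
  have h₂ : S x / 2 + (g / (2 * w x) * S x + w x * deriv S x) =
      (C x + w x * S x) / (2 * w x) := by
    rw [← key]
    field_simp
    ring
  simp only [Pi.add_apply, Pi.mul_apply]
  rw [h₂, branch]
  field_simp

/-- The difference of the squared components of the reduced polar map. -/
noncomputable def gap (k w x : ℝ) : ℝ := branch k w x ^ 2 - branch k (-w) x ^ 2

theorem gap_neg (k w x : ℝ) : gap k (-w) x = -gap k w x := by
  simp [gap]

theorem branch_ne_zero_or (k : ℝ) {w x : ℝ} (hS : S x ≠ 0) (hw : w ≠ 0) :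
    branch k w x ≠ 0 ∨ branch k (-w) x ≠ 0 := by
  by_contra! h
  simp only [branch, mul_eq_zero, exp_ne_zero, false_or] at h
  exact mul_ne_zero hw hS (by linarith)

/-- Along a level curve of the product of the components, `gap` increases with `x`. -/
theorem strictMonoOn_gap {k r x₁ x₂ : ℝ} (hk : 0 ≤ k) (hx₁ : -π ^ 2 < x₁)
    (hr : k * (2 * r ^ 2 * (deriv S x₁ / S x₁ ^ 3)) < k + 1)
    (hC : ∀ x ∈ Set.Ioo x₁ x₂, 1 - r ^ 2 < C x ^ 2) :
    StrictMonoOn (fun x => gap k √(x + (r / S x) ^ 2) x) (Set.Icc x₁ x₂) := by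
  have hS : ∀ x ∈ Set.Icc x₁ x₂, 0 < S x := fun x hx => S_pos (hx₁.trans_le hx.1)
  have cC : Continuous C := continuous_iff_continuousAt.2 fun x => (hasDerivAt_C x).continuousAt
  have cS : Continuous S := continuous_iff_continuousAt.2 fun x => (hasDerivAt_S x).continuousAt
  refine strictMonoOn_of_deriv_pos (convex_Icc _ _) ?_ fun x hx => ?_
  · have cw : ContinuousOn (fun x => √(x + (r / S x) ^ 2)) (Set.Icc x₁ x₂) :=
      (continuousOn_id.add ((continuousOn_const.div cS.continuousOn
        fun x hx => (hS x hx).ne').pow 2)).sqrt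
    unfold gap branch
    fun_prop
  · rw [interior_Icc] at hx
    have hSx := hS x (Set.Ioo_subset_Icc_self hx)
    have hpos : 0 < x + (r / S x) ^ 2 := by
      have h := hC x hx
      rw [C_sq] at h
      have : x + (r / S x) ^ 2 = (x * S x ^ 2 + r ^ 2) / S x ^ 2 := by field_simp
      rw [this]
      exact div_pos (by linarith) (by positivity)
    set g := 1 - 2 * r ^ 2 * (deriv S x / S x ^ 3) with hg
    have hdG : HasDerivAt (fun x => x + (r / S x) ^ 2) g x := by
      refine ((hasDerivAt_id x).add
        (((hasDerivAt_const x r).div (hasDerivAt_S x) hSx.ne').pow 2)).congr_deriv ?_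
      simp only [Pi.div_apply, hg]
      simp only [Nat.cast_ofNat, Nat.add_one_sub_one, pow_one, zero_mul, zero_sub]
      field_simp
      ring
    have hw : 0 < √(x + (r / S x) ^ 2) := Real.sqrt_pos.2 hpos
    have hw₂ := Real.sq_sqrt hpos.le
    have hdw := hdG.sqrt hpos.ne'
    have hq := hasDerivAt_branch k hSx.ne' hw₂ hw.ne' hdw
    have hp := hasDerivAt_branch k (w := fun x => -√(x + (r / S x) ^ 2)) hSx.ne'
      (by rw [neg_sq]; exact hw₂) (neg_ne_zero.2 hw.ne')
      (hdw.neg.congr_deriv (by rw [mul_neg, div_neg]))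
    have hgap : HasDerivAt (fun x => gap k √(x + (r / S x) ^ 2) x) _ x :=
      (hq.pow 2).sub (hp.pow 2)
    rw [hgap.deriv]
    have hg₁ : 0 < k * g + 1 := by
      have h := antitoneOn_deriv_S_div_S_pow hx₁ (hx₁.trans hx.1) hx.1.le
      have h' : k * (2 * r ^ 2 * (deriv S x / S x ^ 3)) ≤
          k * (2 * r ^ 2 * (deriv S x₁ / S x₁ ^ 3)) := by
        have := mul_le_mul_of_nonneg_left h (by positivity : 0 ≤ k * (2 * r ^ 2))
        linarith
      linarith
    have hne := branch_ne_zero_or k hSx.ne' hw.ne'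
    rw [← hg]
    set w := √(x + (r / S x) ^ 2)
    have hsum : 0 < branch k w x ^ 2 + branch k (-w) x ^ 2 := by
      rcases hne with h | h <;> positivity
    have : 0 < (branch k w x ^ 2 + branch k (-w) x ^ 2) * ((k * g + 1) / w) := by positivity
    convert this using 1
    field_simp
    norm_num
    ring

theorem gap_lt_gap {k y₁ b₁ x₁ y₂ b₂ x₂ : ℝ} (hk : 0 ≤ k) (hx₁ : -π ^ 2 < x₁)
    (e₁ : x₁ = y₁ ^ 2 - b₁ ^ 2) (e₂ : x₂ = y₂ ^ 2 - b₂ ^ 2) (hy₁ : 0 ≤ y₁) (hy₂ : 0 ≤ y₂)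
    (hb : b₁ * S x₁ = b₂ * S x₂) (hcond : k * (2 * b₁ ^ 2 * deriv S x₁) < (k + 1) * S x₁)
    (hlt : x₁ < x₂) (hC : ∀ x ∈ Set.Ioo x₁ x₂, 1 - (b₁ * S x₁) ^ 2 < C x ^ 2) :
    gap k y₁ x₁ < gap k y₂ x₂ := by
  have hS₁ := S_pos hx₁
  have hS₂ := S_pos (hx₁.trans hlt)
  have hr : k * (2 * (b₁ * S x₁) ^ 2 * (deriv S x₁ / S x₁ ^ 3)) < k + 1 := by
    have : k * (2 * (b₁ * S x₁) ^ 2 * (deriv S x₁ / S x₁ ^ 3)) =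
        k * (2 * b₁ ^ 2 * deriv S x₁) / S x₁ := by field_simp
    rwa [this, div_lt_iff₀ hS₁]
  have h := strictMonoOn_gap hk hx₁ hr hC (Set.left_mem_Icc.2 hlt.le)
    (Set.right_mem_Icc.2 hlt.le) hlt
  have w₁ : √(x₁ + (b₁ * S x₁ / S x₁) ^ 2) = y₁ := by
    rw [mul_div_cancel_right₀ _ hS₁.ne', show x₁ + b₁ ^ 2 = y₁ ^ 2 by linarith, Real.sqrt_sq hy₁]
  have w₂ : √(x₂ + (b₁ * S x₁ / S x₂) ^ 2) = y₂ := by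
    rw [hb, mul_div_cancel_right₀ _ hS₂.ne', show x₂ + b₂ ^ 2 = y₂ ^ 2 by linarith,
      Real.sqrt_sq hy₂]
  simpa only [w₁, w₂] using h

theorem lt_C_sq_of_mem_Ioo {c x₁ x₂ x : ℝ} (hx₁ : -π ^ 2 < x₁) (hx : x ∈ Set.Ioo x₁ x₂)
    (h₁ : c ≤ C x₁ ^ 2) (h₂ : c ≤ C x₂ ^ 2) (hC : 0 ≤ C x₁ * C x₂) : c < C x ^ 2 := by
  have l₁ := strictMonoOn_C hx₁ (hx₁.trans hx.1) hx.1
  have l₂ := strictMonoOn_C (hx₁.trans hx.1) (hx₁.trans (hx.1.trans hx.2)) hx.2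
  rcases le_or_gt 0 (C x₁) with h | h
  · nlinarith
  · have : C x₂ ≤ 0 := nonpos_of_mul_nonneg_right hC h
    nlinarith

theorem C_mul_C_nonneg {k y₁ b₁ x₁ y₂ x₂ : ℝ} (e₁ : x₁ = y₁ ^ 2 - b₁ ^ 2)
    (hr : (b₁ * S x₁) ^ 2 ≤ 1) (hQ : branch k y₁ x₁ = branch k y₂ x₂)
    (hP : branch k (-y₁) x₁ = branch k (-y₂) x₂) : 0 ≤ C x₁ * C x₂ := by
  have h₁ := C_eq_branch k y₁ x₁
  have h₂ := C_eq_branch k y₂ x₂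
  have h := branch_mul_branch_neg k e₁
  rw [← hQ, ← hP] at h₂
  set P := branch k (-y₁) x₁
  set Q := branch k y₁ x₁
  have hPQ : 0 ≤ Q * P := by linarith
  have : 4 * (C x₁ * C x₂) = exp (k * -y₁) * exp (k * -y₂) * Q ^ 2 +
      exp (k * y₁) * exp (k * y₂) * P ^ 2 +
      (exp (k * -y₁) * exp (k * y₂) + exp (k * y₁) * exp (k * -y₂)) * (Q * P) := by
    linear_combination (2 * C x₂) * h₁ +
      (exp (k * -y₁) * Q + exp (k * y₁) * P) * h₂
  have : 0 ≤ 4 * (C x₁ * C x₂) := by rw [this]; positivity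
  linarith

theorem mul_S_eq_of_branch_eq {k y₁ b₁ x₁ y₂ b₂ x₂ : ℝ} (hx₁ : -π ^ 2 < x₁) (hx₂ : -π ^ 2 < x₂)
    (e₁ : x₁ = y₁ ^ 2 - b₁ ^ 2) (e₂ : x₂ = y₂ ^ 2 - b₂ ^ 2) (hb₁ : 0 ≤ b₁) (hb₂ : 0 ≤ b₂)
    (hQ : branch k y₁ x₁ = branch k y₂ x₂) (hP : branch k (-y₁) x₁ = branch k (-y₂) x₂) :
    b₁ * S x₁ = b₂ * S x₂ := by
  have h₁ := branch_mul_branch_neg k e₁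
  have h₂ := branch_mul_branch_neg k e₂
  rw [hQ, hP] at h₁
  exact (pow_left_inj₀ (mul_nonneg hb₁ (S_pos hx₁).le) (mul_nonneg hb₂ (S_pos hx₂).le)
    two_ne_zero).1 (by linarith)

theorem not_lt_of_branch_eq {k y₁ b₁ x₁ y₂ b₂ x₂ : ℝ} (hk : 0 ≤ k) (hx₁ : -π ^ 2 < x₁)
    (e₁ : x₁ = y₁ ^ 2 - b₁ ^ 2) (e₂ : x₂ = y₂ ^ 2 - b₂ ^ 2) (hy₁ : 0 ≤ y₁) (hy₂ : 0 ≤ y₂)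
    (hb : b₁ * S x₁ = b₂ * S x₂) (hcond : k * (2 * b₁ ^ 2 * deriv S x₁) < (k + 1) * S x₁)
    (hQ : branch k y₁ x₁ = branch k y₂ x₂) (hP : branch k (-y₁) x₁ = branch k (-y₂) x₂) :
    ¬ x₁ < x₂ := by
  intro hlt
  refine (gap_lt_gap hk hx₁ e₁ e₂ hy₁ hy₂ hb hcond hlt fun x hx => ?_).ne
    (by rw [gap, gap, hQ, hP])
  rcases lt_or_ge 1 ((b₁ * S x₁) ^ 2) with hr | hr
  · nlinarith [sq_nonneg (C x)]
  · refine lt_C_sq_of_mem_Ioo hx₁ hx ?_ ?_ (C_mul_C_nonneg e₁ hr hQ hP)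
    · rw [C_sq_eq e₁]
      nlinarith [sq_nonneg (y₁ * S x₁)]
    · rw [C_sq_eq e₂, ← hb]
      nlinarith [sq_nonneg (y₂ * S x₂)]

theorem branch_neg_lt_branch {k y x : ℝ} (hk : 0 ≤ k) (hy : 0 < y) (hS : 0 < S x)
    (hC : y * S x ≤ C x) : branch k (-y) x < branch k y x := by
  have hA : 0 < y * S x := mul_pos hy hS
  have h₁ : 1 ≤ exp (k * y) := Real.one_le_exp (by positivity)
  have h₂ : exp (k * -y) ≤ 1 := Real.exp_le_one_iff.2 (by nlinarith)
  unfold branch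
  nlinarith

theorem gap_neg_of_C_neg {k y b x : ℝ} (hk : 0 ≤ k) (hx : -π ^ 2 < x) (e : x = y ^ 2 - b ^ 2)
    (hy : 0 < y) (hcond : k * (2 * b ^ 2 * deriv S x) < (k + 1) * S x)
    (hr : (b * S x) ^ 2 ≤ 1) (hC : C x < 0) : gap k y x < 0 := by
  have hS := S_pos hx
  have hsq := C_sq_eq e
  have hA : 0 < (y * S x) ^ 2 := by positivity
  set v := √(1 - (b * S x) ^ 2) with hv
  have hv₀ : 0 ≤ v := Real.sqrt_nonneg _
  have hv₂ : v ^ 2 = 1 - (b * S x) ^ 2 := Real.sq_sqrt (by linarith)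
  have hCv : C x < -v := by nlinarith
  have hx₀ : x ≤ 0 := by
    by_contra! h
    have := strictMonoOn_C (neg_lt_zero.2 (pow_pos pi_pos 2)) hx h
    rw [C_zero] at this
    linarith
  obtain ⟨z, hz, hCz⟩ := intermediate_value_Icc hx₀
    (fun z _ => (hasDerivAt_C z).continuousAt.continuousWithinAt)
    (⟨hCv.le, by rw [C_zero]; linarith⟩ : -v ∈ Set.Icc (C x) (C 0))
  have hxz : x < z := lt_of_le_of_ne hz.1 fun h => by rw [← h] at hCz; linarith
  have hSz := S_pos (hx.trans hxz)
  have hz_eq : z = 0 ^ 2 - (b * S x / S z) ^ 2 := by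
    have h := C_sq z
    rw [hCz, neg_sq, hv₂] at h
    field_simp
    linarith
  have h := gap_lt_gap hk hx e hz_eq hy.le le_rfl (by field_simp) hcond hxz fun t ht => by
    have := strictMonoOn_C (hx.trans ht.1) (hx.trans hxz) ht.2
    nlinarith
  simpa [gap] using h

theorem branch_opposite_ne {k y₁ b₁ x₁ y₂ b₂ x₂ : ℝ} (hk : 0 ≤ k) (hx₁ : -π ^ 2 < x₁)
    (hx₂ : -π ^ 2 < x₂) (e₁ : x₁ = y₁ ^ 2 - b₁ ^ 2) (e₂ : x₂ = y₂ ^ 2 - b₂ ^ 2)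
    (hb : b₁ * S x₁ = b₂ * S x₂)
    (hcond₁ : k * (2 * b₁ ^ 2 * deriv S x₁) < (k + 1) * S x₁)
    (hcond₂ : k * (2 * b₂ ^ 2 * deriv S x₂) < (k + 1) * S x₂)
    (hQ : branch k y₁ x₁ = branch k y₂ x₂) (hP : branch k (-y₁) x₁ = branch k (-y₂) x₂)
    (hy₁ : 0 < y₁) (hy₂ : y₂ < 0) : False := by
  have hS₁ := S_pos hx₁
  have hS₂ := S_pos hx₂
  have hA₁ : 0 < y₁ * S x₁ := mul_pos hy₁ hS₁
  have hA₂ : y₂ * S x₂ < 0 := mul_neg_of_neg_of_pos hy₂ hS₂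
  have q₁ := C_sq_eq e₁
  have q₂ := C_sq_eq e₂
  rw [← hb] at q₂
  rcases lt_or_ge 1 ((b₁ * S x₁) ^ 2) with hr | hr
  · have p₁ : 0 < branch k y₁ x₁ := mul_pos (exp_pos _) (by nlinarith)
    have p₂ : branch k y₂ x₂ < 0 := mul_neg_of_pos_of_neg (exp_pos _) (by nlinarith)
    linarith
  · have hCC := C_mul_C_nonneg e₁ hr hQ hP
    have hC₂ : C x₂ ≠ 0 := fun h => by rw [h] at q₂; nlinarith
    have hC₁ : C x₁ ≠ 0 := fun h => by rw [h] at q₁; nlinarith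
    rcases hC₁.lt_or_gt with h | h
    · have h₂ : C x₂ < 0 := (nonpos_of_mul_nonneg_right hCC h).lt_of_ne hC₂
      have g₁ := gap_neg_of_C_neg hk hx₁ e₁ hy₁ hcond₁ hr h
      have g₂ := gap_neg_of_C_neg hk hx₂ (e₂.trans (by ring)) (neg_pos.2 hy₂) hcond₂
        (hb ▸ hr) h₂
      rw [gap_neg] at g₂
      rw [gap, hQ, hP, ← gap] at g₁
      linarith
    · have h₂ : 0 < C x₂ := (nonneg_of_mul_nonneg_right hCC h).lt_of_ne' hC₂
      have g₁ := branch_neg_lt_branch hk hy₁ hS₁ (by nlinarith)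
      have g₂ := branch_neg_lt_branch hk (neg_pos.2 hy₂) hS₂ (by nlinarith)
      rw [neg_neg] at g₂
      linarith

theorem branch_injective {k y₁ b₁ x₁ y₂ b₂ x₂ : ℝ} (hk : 0 ≤ k) (hx₁ : -π ^ 2 < x₁)
    (hx₂ : -π ^ 2 < x₂) (e₁ : x₁ = y₁ ^ 2 - b₁ ^ 2) (e₂ : x₂ = y₂ ^ 2 - b₂ ^ 2)
    (hb₁ : 0 ≤ b₁) (hb₂ : 0 ≤ b₂)
    (hcond₁ : k * (2 * b₁ ^ 2 * deriv S x₁) < (k + 1) * S x₁)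
    (hcond₂ : k * (2 * b₂ ^ 2 * deriv S x₂) < (k + 1) * S x₂)
    (hQ : branch k y₁ x₁ = branch k y₂ x₂) (hP : branch k (-y₁) x₁ = branch k (-y₂) x₂) :
    y₁ = y₂ ∧ b₁ = b₂ := by
  have hb := mul_S_eq_of_branch_eq hx₁ hx₂ e₁ e₂ hb₁ hb₂ hQ hP
  have finish (hx : x₁ = x₂) (hy : 0 ≤ y₁ * y₂) : y₁ = y₂ ∧ b₁ = b₂ := by
    have hbb : b₁ = b₂ := mul_right_cancel₀ (S_pos hx₁).ne' (by rw [hb, hx])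
    refine ⟨?_, hbb⟩
    rcases sq_eq_sq_iff_eq_or_eq_neg.1 (by rw [hbb] at e₁; linarith : y₁ ^ 2 = y₂ ^ 2) with h | h
    · exact h
    · rw [h] at hy ⊢
      have : y₂ = 0 := pow_eq_zero_iff two_ne_zero |>.1 (by nlinarith)
      simp [this]
  have same (hy₁ : 0 ≤ y₁) (hy₂ : 0 ≤ y₂) : x₁ = x₂ :=
    le_antisymm
      (not_lt.1 (not_lt_of_branch_eq hk hx₂ e₂ e₁ hy₂ hy₁ hb.symm hcond₂ hQ.symm hP.symm))
      (not_lt.1 (not_lt_of_branch_eq hk hx₁ e₁ e₂ hy₁ hy₂ hb hcond₁ hQ hP))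
  have same_neg (hy₁ : y₁ ≤ 0) (hy₂ : y₂ ≤ 0) : x₁ = x₂ := by
    have f₁ : x₁ = (-y₁) ^ 2 - b₁ ^ 2 := e₁.trans (by ring)
    have f₂ : x₂ = (-y₂) ^ 2 - b₂ ^ 2 := e₂.trans (by ring)
    have hQ' : branch k (-(-y₁)) x₁ = branch k (-(-y₂)) x₂ := by simpa using hQ
    have n₁ := neg_nonneg.2 hy₁
    have n₂ := neg_nonneg.2 hy₂
    exact le_antisymm
      (not_lt.1 (not_lt_of_branch_eq hk hx₂ f₂ f₁ n₂ n₁ hb.symm hcond₂ hP.symm hQ'.symm))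
      (not_lt.1 (not_lt_of_branch_eq hk hx₁ f₁ f₂ n₁ n₂ hb hcond₁ hP hQ'))
  rcases le_or_gt 0 y₁ with h₁ | h₁ <;> rcases le_or_gt 0 y₂ with h₂ | h₂
  · exact finish (same h₁ h₂) (mul_nonneg h₁ h₂)
  · rcases h₁.eq_or_lt with h | h
    · exact finish (same_neg h.ge h₂.le) (by simp [← h])
    · exact (branch_opposite_ne hk hx₁ hx₂ e₁ e₂ hb hcond₁ hcond₂ hQ hP h h₂).elim
  · rcases h₂.eq_or_lt with h | h
    · exact finish (same_neg h₁.le h.ge) (by simp [← h])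
    · exact (branch_opposite_ne hk hx₂ hx₁ e₂ e₁ hb.symm hcond₂ hcond₁ hQ.symm hP.symm h h₁).elim
  · exact finish (same_neg h₁.le h₂.le) (mul_nonneg_of_nonpos_of_nonpos h₁.le h₂.le)

theorem Phi_eq_branch {m : ℝ} (hm : m < 0) (p : ℝ × ℝ) :
    Phi m p = (branch ((1 + m) / -m) (-(-2 * p.1 * m)) (4 * p.1 ^ 2 * m ^ 2 - 4 * p.2 ^ 2),
      branch ((1 + m) / -m) (-2 * p.1 * m) (4 * p.1 ^ 2 * m ^ 2 - 4 * p.2 ^ 2)) := by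
  have h : (1 + m) / -m * (-2 * p.1 * m) = 2 * p.1 * (1 + m) := by
    have := hm.ne
    field_simp
  unfold Phi branch
  rw [mul_neg, h]
  refine Prod.ext ?_ ?_ <;> ring_nf

theorem two_mul_deriv_S_lt_S {m t b x : ℝ} (hx : -π ^ 2 < x) (e : x = t ^ 2 * m ^ 2 - b ^ 2)
    (h : t ^ 2 * m ^ 2 + b ^ 2 * m < C x / (2 * deriv S x)) :
    (1 + m) * (2 * b ^ 2 * deriv S x) < S x := by
  rw [lt_div_iff₀ (mul_pos two_pos (deriv_S_pos hx)), C_eq_S_add] at h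
  linear_combination h + (2 * deriv S x) * e

theorem Phi_zero_injOn {p q : ℝ × ℝ} (hp₂ : 0 ≤ p.2) (hq₂ : 0 ≤ q.2)
    (hp : -π ^ 2 < -(4 * p.2 ^ 2)) (hq : -π ^ 2 < -(4 * q.2 ^ 2))
    (hCp : 0 < C (-(4 * p.2 ^ 2))) (hCq : 0 < C (-(4 * q.2 ^ 2)))
    (h : Phi 0 p = Phi 0 q) : p = q := by
  have h₁ := congrArg Prod.fst h
  have h₂ := congrArg Prod.snd h
  simp only [Phi, add_zero, mul_one, mul_zero, zero_mul, ne_eq, OfNat.ofNat_ne_zero,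
    not_false_eq_true, zero_pow, zero_sub, sub_zero] at h₁ h₂
  have key (u c : ℝ) : exp (-(2 * u)) * c * (exp (2 * u) * c) = c ^ 2 := by
    have : exp (-(2 * u)) * exp (2 * u) = 1 := by rw [← exp_add]; simp
    linear_combination c ^ 2 * this
  have hC : C (-(4 * p.2 ^ 2)) = C (-(4 * q.2 ^ 2)) := by
    refine (pow_left_inj₀ hCp.le hCq.le two_ne_zero).1 ?_
    rw [← key p.1, ← key q.1 (C _), h₁, h₂]
  have hx := strictMonoOn_C.injOn hp hq hC
  rw [hC] at h₂
  have he := exp_injective (mul_right_cancel₀ hCq.ne' h₂)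
  exact Prod.ext (by linarith) ((pow_left_inj₀ hp₂ hq₂ two_ne_zero).1 (by linarith))

/-- For `-1 < m ≤ 0`, let `Sₘ = {(u,a) : a ≥ 0, x := 4u²m² - 4a² > -π²,
4u²m² + 4a²m < C(x)/(2S'(x))}` and let `Σₘ` be the connected component of `(0,0)` in `Sₘ`.
Then `Φₘ` is injective on `Σₘ` (hence the polar map `Pₘ` of the maximal adapted
complexification `Ωₘ` is injective). -/
theorem stmt18 (m : ℝ) (hm₁ : -1 < m) (hm₂ : m ≤ 0) :
    Set.InjOn (Phi m)
      (connectedComponentIn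
        {p : ℝ × ℝ | 0 ≤ p.2 ∧ 4 * p.1 ^ 2 * m ^ 2 - 4 * p.2 ^ 2 > -π ^ 2 ∧
          4 * p.1 ^ 2 * m ^ 2 + 4 * p.2 ^ 2 * m <
            C (4 * p.1 ^ 2 * m ^ 2 - 4 * p.2 ^ 2) /
              (2 * deriv S (4 * p.1 ^ 2 * m ^ 2 - 4 * p.2 ^ 2))}
        (0, 0)) := by
  refine Set.InjOn.mono (connectedComponentIn_subset _ _) ?_
  rintro p ⟨hp₂, hpx, hp⟩ q ⟨hq₂, hqx, hq⟩ h
  rw [gt_iff_lt] at hpx hqx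
  rcases hm₂.eq_or_lt with rfl | hm
  · have hC {x : ℝ} (hx : -π ^ 2 < x) (h0 : 0 < C x / (2 * deriv S x)) : 0 < C x :=
      (div_pos_iff_of_pos_right (mul_pos two_pos (deriv_S_pos hx))).1 h0
    have hp₀ := hC hpx (by simpa using hp)
    have hq₀ := hC hqx (by simpa using hq)
    norm_num at hpx hqx hp₀ hq₀
    exact Phi_zero_injOn hp₂ hq₂ (by linarith) (by linarith) hp₀ hq₀ h
  · have cond (r : ℝ × ℝ) (hx : 4 * r.1 ^ 2 * m ^ 2 - 4 * r.2 ^ 2 > -π ^ 2)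
        (hr : 4 * r.1 ^ 2 * m ^ 2 + 4 * r.2 ^ 2 * m <
          C (4 * r.1 ^ 2 * m ^ 2 - 4 * r.2 ^ 2) /
            (2 * deriv S (4 * r.1 ^ 2 * m ^ 2 - 4 * r.2 ^ 2))) :
        (1 + m) / -m * (2 * (2 * r.2) ^ 2 * deriv S (4 * r.1 ^ 2 * m ^ 2 - 4 * r.2 ^ 2)) <
          ((1 + m) / -m + 1) * S (4 * r.1 ^ 2 * m ^ 2 - 4 * r.2 ^ 2) := by
      have h := two_mul_deriv_S_lt_S (m := m) (t := 2 * r.1) (b := 2 * r.2) hx (by ring)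
        (by convert hr using 1; ring)
      have hk : (1 + m) / -m + 1 = 1 / -m := by
        have := hm.ne
        field_simp
        ring
      rw [hk, div_mul_eq_mul_div, div_mul_eq_mul_div, one_mul]
      exact div_lt_div_of_pos_right h (neg_pos.2 hm)
    rw [Phi_eq_branch hm, Phi_eq_branch hm, Prod.mk.injEq] at h
    obtain ⟨h₁, h₂⟩ := branch_injective (b₁ := 2 * p.2) (b₂ := 2 * q.2)
      (div_nonneg (by linarith) (by linarith)) hpx hqx (by ring) (by ring) (by linarith)
      (by linarith) (cond p hpx hp) (cond q hqx hq) h.2 h.1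
    exact Prod.ext (by nlinarith [mul_right_cancel₀ hm.ne h₁]) (by linarith)
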